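/- arXiv:1312.1656 — 3 statements merged into one kernel-verified Lean document; each statement's English description precedes it below -/
import Mathlib

section
/- Let p,q,r ∈ [0,1] with p+q+r = 1 and 0 < q < p, let a ∈ (0,1), and let P be the birth-and-death stochastic matrix on ℕ with P(0,0)=a, P(0,1)=1−a and, for n ≥ 1, P(n,n−1)=p, P(n,n)=r, P(n,n+1)=q. Set γ̂ := √(p/q), V_γ̂(n) := γ̂^n, a₀ := 1−q−√(pq), and let π be an invariant probability distribution of P with ∑_n π(n) γ̂^n < ∞. If a ∈ (a₀,1), then P is V_γ̂-geometrically ergodic and the convergence rate satisfies ρ_{V_γ̂}(P) = r + 2√(pq). -/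
/-- Action of an infinite matrix `P` on functions `f : ℕ → ℂ`: `(Pf)(i) = ∑_j P(i,j) f(j)`. -/
noncomputable def matActC (P : ℕ → ℕ → ℝ) (f : ℕ → ℂ) : ℕ → ℂ :=
  fun i => ∑' j, (P i j : ℂ) * f j

/-- The set of geometric rates `ρ ∈ (0,1)` for which
`‖P^n f - π(f)·1‖_V ≤ C ρ^n` uniformly over `‖f‖_V ≤ 1`. -/
def ergSet (P : ℕ → ℕ → ℝ) (π : ℕ → ℝ) (V : ℕ → ℝ) : Set ℝ :=
  {ρ : ℝ | 0 < ρ ∧ ρ < 1 ∧ ∃ C : ℝ, 0 < C ∧ ∀ n : ℕ, ∀ f : ℕ → ℂ,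
    (∀ m, ‖f m‖ ≤ V m) →
      ∀ m, ‖(matActC P)^[n] f m - ∑' i, (π i : ℂ) * f i‖ ≤ C * ρ ^ n * V m}
/-- Rows of a tridiagonal sum. -/
lemma aux_tsum_zero {E : Type*} [NormedAddCommGroup E] (g : ℕ → E)
    (h : ∀ j, 2 ≤ j → g j = 0) : HasSum g (g 0 + g 1) := by
  have := hasSum_sum_of_ne_finset_zero (L := SummationFilter.unconditional ℕ) (f := g) (s := Finset.range 2) (by
    intro b hb
    apply h
    rw [Finset.mem_range] at hb
    omega)
  simpa [Finset.sum_range_succ] using this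

lemma aux_tsum_succ {E : Type*} [NormedAddCommGroup E] (g : ℕ → E) (n : ℕ)
    (h : ∀ j, j ≠ n → j ≠ n + 1 → j ≠ n + 2 → g j = 0) :
    HasSum g (g n + g (n + 1) + g (n + 2)) := by
  have := hasSum_sum_of_ne_finset_zero (L := SummationFilter.unconditional ℕ) (f := g) (s := {n, n + 1, n + 2}) (by
    intro b hb
    simp only [Finset.mem_insert, Finset.mem_singleton, not_or] at hb
    exact h b hb.1 hb.2.1 hb.2.2)
  rw [Finset.sum_insert (by simp), Finset.sum_insert (by simp), Finset.sum_singleton] at this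
  simpa [add_assoc] using this

lemma aux_diff (p q r a s γ : ℝ) (hp : 0 < p) (hq : 0 < q) (hr : 0 ≤ r) (hγ : 1 < γ)
    (h1 : p = s * γ) (h2 : q * γ = s) (hb : |a - p| ≤ r + s)
    (hsum : p + q + r = 1) (T : (ℕ → ℂ) → ℕ → ℂ)
    (hT0 : ∀ f, T f 0 = a * f 0 + (1 - a) * f 1)
    (hT : ∀ f n, T f (n + 1) = p * f n + r * f (n + 1) + q * f (n + 2))
    (f : ℕ → ℂ) (K : ℝ) (hf : ∀ m, ‖f (m + 1) - f m‖ ≤ K * γ ^ m) (m : ℕ) :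
    ‖T f (m + 1) - T f m‖ ≤ K * (r + 2 * s) * γ ^ m := by
  have hc : (p : ℂ) + q + r = 1 := by exact_mod_cast hsum
  have hK : 0 ≤ K := by
    have := (norm_nonneg _).trans (hf 0)
    simpa using this
  rcases m with _ | m
  · have e : T f (0 + 1) - T f 0 = ((a - p : ℝ) : ℂ) * (f 1 - f 0) + q * (f 2 - f 1) := by
      rw [hT, hT0]
      push_cast
      linear_combination (f 1) * hc
    rw [e]
    have k0 := hf 0
    have k1 := hf 1
    simp only [zero_add, pow_zero, pow_one, mul_one, Nat.reduceAdd] at k0 k1 ⊢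
    calc _ ≤ |a - p| * ‖f 1 - f 0‖ + q * ‖f 2 - f 1‖ := by
          refine (norm_add_le _ _).trans ?_
          rw [norm_mul, norm_mul, Complex.norm_real, Complex.norm_real, Real.norm_eq_abs,
            Real.norm_eq_abs, abs_of_pos hq]
      _ ≤ (r + s) * K + q * (K * γ) := by gcongr; exact (abs_nonneg _).trans hb
      _ = _ := by rw [← h2]; ring
  · have e : T f (m + 1 + 1) - T f (m + 1) = p * (f (m + 1) - f m)
        + r * (f (m + 1 + 1) - f (m + 1)) + q * (f (m + 2 + 1) - f (m + 2)) := by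
      rw [hT, hT]; ring
    rw [e]
    calc _ ≤ p * ‖f (m + 1) - f m‖ + r * ‖f (m + 1 + 1) - f (m + 1)‖
            + q * ‖f (m + 2 + 1) - f (m + 2)‖ := by
          refine (norm_add₃_le).trans ?_
          rw [norm_mul, norm_mul, norm_mul, Complex.norm_real, Complex.norm_real,
            Complex.norm_real, Real.norm_eq_abs,
            Real.norm_eq_abs, Real.norm_eq_abs, abs_of_pos hq, abs_of_pos hp, abs_of_nonneg hr]
      _ ≤ p * (K * γ ^ m) + r * (K * γ ^ (m + 1)) + q * (K * γ ^ (m + 2)) := by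
          gcongr
          · exact hf _
          · exact hf _
          · exact hf _
      _ = _ := by rw [h1, ← h2]; ring

lemma aux_bound (p q r a s γ : ℝ) (hp : 0 < p) (hq : 0 < q) (hr : 0 ≤ r) (hγ : 1 < γ)
    (ha0 : 0 < a) (ha1 : a < 1)
    (h1 : p = s * γ) (h2 : q * γ = s) (hlt : r + 2 * s < 1) (T : (ℕ → ℂ) → ℕ → ℂ)
    (hT0 : ∀ f, T f 0 = a * f 0 + (1 - a) * f 1)
    (hT : ∀ f n, T f (n + 1) = p * f n + r * f (n + 1) + q * f (n + 2))
    (f : ℕ → ℂ) (K : ℝ) (hf : ∀ m, ‖f m‖ ≤ K * γ ^ m) (m : ℕ) :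
    ‖T f m‖ ≤ K * γ * γ ^ m := by
  have hK : 0 ≤ K := by
    have := (norm_nonneg _).trans (hf 0)
    simpa using this
  rcases m with _ | m
  · rw [hT0]
    have k0 := hf 0
    have k1 := hf 1
    simp only [pow_zero, pow_one, mul_one] at k0 k1 ⊢
    have e : (1 - a : ℂ) = ((1 - a : ℝ) : ℂ) := by push_cast; rfl
    calc _ ≤ a * ‖f 0‖ + (1 - a) * ‖f 1‖ := by
          refine (norm_add_le _ _).trans ?_
          rw [e, norm_mul, norm_mul, Complex.norm_real, Complex.norm_real, Real.norm_eq_abs,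
            Real.norm_eq_abs, abs_of_pos ha0, abs_of_pos (by linarith)]
      _ ≤ a * K + (1 - a) * (K * γ) := by
          have : 0 ≤ 1 - a := by linarith
          gcongr
      _ ≤ a * (K * γ) + (1 - a) * (K * γ) := by
          have : K ≤ K * γ := by nlinarith
          gcongr
      _ = _ := by ring
  · rw [hT]
    calc _ ≤ p * ‖f m‖ + r * ‖f (m + 1)‖ + q * ‖f (m + 2)‖ := by
          refine (norm_add₃_le).trans ?_
          rw [norm_mul, norm_mul, norm_mul, Complex.norm_real, Complex.norm_real,
            Complex.norm_real, Real.norm_eq_abs,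
            Real.norm_eq_abs, Real.norm_eq_abs, abs_of_pos hq, abs_of_pos hp, abs_of_nonneg hr]
      _ ≤ p * (K * γ ^ m) + r * (K * γ ^ (m + 1)) + q * (K * γ ^ (m + 2)) := by
          gcongr
          · exact hf _
          · exact hf _
          · exact hf _
      _ = (r + 2 * s) * (K * γ ^ (m + 1)) := by rw [h1, ← h2]; ring
      _ ≤ γ * (K * γ ^ (m + 1)) := by gcongr; linarith
      _ = _ := by ring

lemma aux_geom (γ K : ℝ) (hγ : 1 < γ) (f : ℕ → ℂ)
    (hf : ∀ m, ‖f (m + 1) - f m‖ ≤ K * γ ^ m) (m : ℕ) :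
    ‖f m - f 0‖ ≤ K / (γ - 1) * γ ^ m := by
  have hK : 0 ≤ K := by
    have := (norm_nonneg _).trans (hf 0)
    simpa using this
  have h0 : 0 < γ - 1 := by linarith
  induction m with
  | zero => simpa using div_nonneg hK h0.le
  | succ m ih =>
    have e : f (m + 1) - f 0 = (f (m + 1) - f m) + (f m - f 0) := by ring
    rw [e]
    refine (norm_add_le _ _).trans ((add_le_add (hf m) ih).trans (le_of_eq ?_))
    field_simp
    ring

set_option maxHeartbeats 1000000 in
/-- for the birth-and-death chain with `0 < q < p`, boundary parameter
`a ∈ (a₀,1)` where `a₀ = 1 - q - √(pq)`, and weight `V(n) = γ̂^n` with `γ̂ = √(p/q)`,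
the chain is `V`-geometrically ergodic with convergence rate `ρ_V(P) = r + 2√(pq)`. -/
theorem bd_rate_large_a
    (p q r a : ℝ)
    (hp0 : 0 ≤ p) (hp1 : p ≤ 1) (hq1 : q ≤ 1) (hr0 : 0 ≤ r) (hr1 : r ≤ 1)
    (hsum : p + q + r = 1) (hq : 0 < q) (hqp : q < p)
    (ha0 : 0 < a) (ha1 : a < 1)
    (P : ℕ → ℕ → ℝ)
    (hP00 : P 0 0 = a) (hP01 : P 0 1 = 1 - a) (hP0 : ∀ j, 2 ≤ j → P 0 j = 0)
    (hPn : ∀ n : ℕ, 1 ≤ n →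
      P n (n - 1) = p ∧ P n n = r ∧ P n (n + 1) = q ∧
      ∀ j, j ≠ n - 1 → j ≠ n → j ≠ n + 1 → P n j = 0)
    (π : ℕ → ℝ) (hπ0 : ∀ n, 0 ≤ π n) (hπsum : HasSum π 1)
    (hπinv : ∀ j, ∑' i, π i * P i j = π j)
    (hπV : Summable (fun n => π n * Real.sqrt (p / q) ^ n))
    (haa0 : 1 - q - Real.sqrt (p * q) < a) :
    (ergSet P π (fun n => Real.sqrt (p / q) ^ n)).Nonempty
    ∧ sInf (ergSet P π (fun n => Real.sqrt (p / q) ^ n)) = r + 2 * Real.sqrt (p * q) := by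
  set γ := Real.sqrt (p / q) with hγdef
  set s := Real.sqrt (p * q) with hsdef
  have hp : 0 < p := hq.trans hqp
  have hγ : 1 < γ := by
    rw [hγdef, Real.lt_sqrt (by norm_num), lt_div_iff₀ hq]; linarith
  have hγ0 : 0 < γ := by linarith
  have hs0 : 0 < s := Real.sqrt_pos.2 (by positivity)
  have hs2 : s ^ 2 = p * q := Real.sq_sqrt (by positivity)
  have hγ2 : γ ^ 2 = p / q := Real.sq_sqrt (by positivity)
  have h2 : q * γ = s := by
    have : (q * γ) ^ 2 = s ^ 2 := by
      rw [mul_pow, hγ2, hs2]; field_simp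
    exact (pow_left_inj₀ (by positivity) hs0.le two_ne_zero).1 this
  have h1 : p = s * γ := by
    have : q * γ ^ 2 = p := by rw [hγ2]; field_simp
    rw [← h2, ← this]; ring
  have hqs : q < s := by nlinarith
  have hlt : r + 2 * s < 1 := by
    have : 0 < q * (γ - 1) ^ 2 := by have : 0 < γ - 1 := by linarith
                                     positivity
    nlinarith
  have hb : |a - p| ≤ r + s := by
    rw [abs_le]; constructor <;> linarith
  have hT0 : ∀ f, matActC P f 0 = a * f 0 + (1 - a) * f 1 := by
    intro f
    unfold matActC
    rw [(aux_tsum_zero (fun j => (P 0 j : ℂ) * f j) (by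
      intro j hj; simp [hP0 j hj])).tsum_eq, hP00, hP01]
    push_cast; rfl
  have hPs : ∀ n, P (n + 1) n = p ∧ P (n + 1) (n + 1) = r ∧ P (n + 1) (n + 2) = q ∧
      ∀ j, j ≠ n → j ≠ n + 1 → j ≠ n + 2 → P (n + 1) j = 0 := by
    intro n
    exact hPn (n + 1) (by omega)
  have hT : ∀ f n, matActC P f (n + 1) = p * f n + r * f (n + 1) + q * f (n + 2) := by
    intro f n
    obtain ⟨e1, e2, e3, e4⟩ := hPs n
    unfold matActC
    rw [(aux_tsum_succ (fun j => (P (n + 1) j : ℂ) * f j) n (by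
      intro j i1 i2 i3; simp [e4 j i1 i2 i3])).tsum_eq, e1, e2, e3]
  -- invariance
  have hsumm : ∀ (f : ℕ → ℂ) (K : ℝ), (∀ m, ‖f m‖ ≤ K * γ ^ m) →
      Summable (fun i => (π i : ℂ) * f i) := by
    intro f K hf
    refine Summable.of_norm_bounded (hπV.mul_left K) ?_
    intro i
    rw [norm_mul, Complex.norm_real, Real.norm_eq_abs, abs_of_nonneg (hπ0 i)]
    nlinarith [mul_le_mul_of_nonneg_left (hf i) (hπ0 i)]
  have hinv : ∀ (f : ℕ → ℂ) (K : ℝ), (∀ m, ‖f m‖ ≤ K * γ ^ m) →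
      ∑' i, (π i : ℂ) * matActC P f i = ∑' i, (π i : ℂ) * f i := by
    intro f K hf
    have hrow0 : ∀ j, 2 ≤ j → ‖(π 0 : ℂ) * ((P 0 j : ℂ) * f j)‖ = 0 := by
      intro j hj; simp [hP0 j hj]
    have hrow : ∀ n j, j ≠ n → j ≠ n + 1 → j ≠ n + 2 →
        ‖(π (n + 1) : ℂ) * ((P (n + 1) j : ℂ) * f j)‖ = 0 := by
      intro n j i1 i2 i3; simp [(hPs n).2.2.2 j i1 i2 i3]
    have hS : Summable (fun x : ℕ × ℕ => (π x.1 : ℂ) * ((P x.1 x.2 : ℂ) * f x.2)) := by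
      apply Summable.of_norm
      rw [summable_prod_of_nonneg (fun _ => norm_nonneg _)]
      constructor
      · intro i
        rcases i with _ | n
        · exact (aux_tsum_zero _ hrow0).summable
        · exact (aux_tsum_succ _ n (hrow n)).summable
      · rw [← summable_nat_add_iff 1]
        refine Summable.of_nonneg_of_le (fun i => tsum_nonneg (fun _ => norm_nonneg _)) ?_
          (((summable_nat_add_iff 1).2 hπV).mul_left (K * (r + 2 * s)))
        intro n
        obtain ⟨e1, e2, e3, e4⟩ := hPs n
        dsimp only
        rw [(aux_tsum_succ _ n (hrow n)).tsum_eq, e1, e2, e3]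
        simp only [norm_mul, Complex.norm_real, Real.norm_eq_abs]
        rw [abs_of_nonneg (hπ0 _), abs_of_pos hp, abs_of_pos hq, abs_of_nonneg hr0]
        have := hπ0 (n + 1)
        calc _ ≤ π (n + 1) * (p * (K * γ ^ n)) + π (n + 1) * (r * (K * γ ^ (n + 1)))
              + π (n + 1) * (q * (K * γ ^ (n + 2))) := by
              gcongr
              · exact hf _
              · exact hf _
              · exact hf _
          _ = _ := by rw [h1, ← h2]; ring
    calc ∑' i, (π i : ℂ) * matActC P f i
        = ∑' i, ∑' j, (π i : ℂ) * ((P i j : ℂ) * f j) := by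
          refine tsum_congr fun i => ?_
          unfold matActC
          rw [tsum_mul_left]
      _ = ∑' j, ∑' i, (π i : ℂ) * ((P i j : ℂ) * f j) := hS.tsum_comm.symm
      _ = _ := by
          refine tsum_congr fun j => ?_
          rw [← hπinv j, Complex.ofReal_tsum, ← tsum_mul_right]
          refine tsum_congr fun i => ?_
          push_cast; ring
  have hmem : r + 2 * s ∈ ergSet P π (fun n => γ ^ n) := by
    set M := ∑' i, π i * γ ^ i with hM
    have hM0 : 0 ≤ M := tsum_nonneg fun i => mul_nonneg (hπ0 i) (by positivity)
    set A := (1 + γ) / (γ - 1) with hA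
    have hA0 : 0 < A := div_pos (by linarith) (by linarith)
    refine ⟨by linarith, hlt, A * (1 + M), by positivity, ?_⟩
    intro n f hf m
    have hiter : (∀ m, ‖(matActC P)^[n] f m‖ ≤ γ ^ n * γ ^ m) ∧
        (∀ m, ‖(matActC P)^[n] f (m + 1) - (matActC P)^[n] f m‖
          ≤ (1 + γ) * (r + 2 * s) ^ n * γ ^ m) ∧
        ∑' i, (π i : ℂ) * (matActC P)^[n] f i = ∑' i, (π i : ℂ) * f i := by
      induction n with
      | zero =>
        refine ⟨fun m => by simpa using hf m, fun m => ?_, rfl⟩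
        refine (norm_sub_le _ _).trans ((add_le_add (hf (m + 1)) (hf m)).trans (le_of_eq ?_))
        ring
      | succ n ih =>
        obtain ⟨i1, i2, i3⟩ := ih
        simp only [Function.iterate_succ_apply']
        refine ⟨fun m => ?_, fun m => ?_, ?_⟩
        · rw [pow_succ γ n]
          exact aux_bound p q r a s γ hp hq hr0 hγ ha0 ha1 h1 h2 hlt _ hT0 hT _ _ i1 m
        · rw [pow_succ (r + 2 * s) n, ← mul_assoc]
          exact aux_diff p q r a s γ hp hq hr0 hγ h1 h2 hb hsum _ hT0 hT _ _ i2 m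
        · rw [hinv _ _ i1, i3]
    obtain ⟨i1, i2, i3⟩ := hiter
    rw [← i3]
    generalize (matActC P)^[n] f = g at i1 i2 i3 ⊢
    have hg := aux_geom γ _ hγ g i2
    set B := (r + 2 * s) ^ n with hB
    have hB0 : 0 < B := pow_pos (by linarith) n
    have hAB : (1 + γ) * B / (γ - 1) = A * B := by rw [hA]; ring
    rw [hAB] at hg
    have hπc : HasSum (fun i => (π i : ℂ)) 1 := by
      have := Complex.hasSum_ofReal.2 hπsum
      rwa [Complex.ofReal_one] at this
    have hd : HasSum (fun i => (π i : ℂ) * (g i - g 0)) ((∑' i, (π i : ℂ) * g i) - 1 * g 0) := by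
      have := (hsumm g _ i1).hasSum.sub (hπc.mul_right (g 0))
      simpa only [mul_sub] using this
    have hd2 : ‖(∑' i, (π i : ℂ) * g i) - 1 * g 0‖ ≤ A * B * M := by
      rw [← hd.tsum_eq]
      refine tsum_of_norm_bounded (hπV.hasSum.mul_left (A * B)) ?_
      intro i
      rw [norm_mul, Complex.norm_real, Real.norm_eq_abs, abs_of_nonneg (hπ0 i)]
      nlinarith [mul_le_mul_of_nonneg_left (hg i) (hπ0 i)]
    have e : g m - ∑' i, (π i : ℂ) * g i = (g m - g 0) - ((∑' i, (π i : ℂ) * g i) - 1 * g 0) := by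
      ring
    rw [e]
    refine (norm_sub_le _ _).trans ((add_le_add (hg m) hd2).trans ?_)
    have : 1 ≤ γ ^ m := one_le_pow₀ hγ.le
    have h3 : A * B * M ≤ A * B * M * γ ^ m := le_mul_of_one_le_right (by positivity) this
    refine (add_le_add_right h3 _).trans (le_of_eq ?_)
    ring
  refine ⟨⟨_, hmem⟩, ?_⟩
  refine IsLeast.csInf_eq ⟨hmem, ?_⟩
  rintro ρ ⟨hρ0, hρ1, C, hC, h⟩
  have key : ∀ n : ℕ, (r + 2 * s) ^ n ≤ C * ρ ^ n := by
    intro n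
    set f : ℕ → ℂ := fun m => (γ : ℂ) ^ m with hf
    have hpow : ∀ n m, n ≤ m → (matActC P)^[n] f m = (((r + 2 * s) ^ n * γ ^ m : ℝ) : ℂ) := by
      intro n
      induction n with
      | zero => intro m _; simp [hf]
      | succ n ih =>
        intro m hm
        obtain ⟨m, rfl⟩ : ∃ k, m = k + 1 := ⟨m - 1, by omega⟩
        rw [Function.iterate_succ_apply', hT, ih m (by omega), ih (m + 1) (by omega),
          ih (m + 2) (by omega)]
        norm_cast
        rw [h1, ← h2]; ring
    have hfb : ∀ m, ‖f m‖ ≤ γ ^ m := by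
      intro m; simp [hf, abs_of_pos hγ0]
    set c := ∑' i, (π i : ℂ) * f i
    have hle : ∀ᶠ m : ℕ in Filter.atTop, (r + 2 * s) ^ n - ‖c‖ * (γ⁻¹) ^ m ≤ C * ρ ^ n := by
      filter_upwards [Filter.eventually_ge_atTop n] with m hm
      have h4 := h n f hfb m
      rw [hpow n m hm] at h4
      have h5 := (norm_sub_norm_le _ _).trans h4
      have hpos : 0 < (r + 2 * s) ^ n := pow_pos (by linarith) n
      have hgp : 0 < γ ^ m := by positivity
      rw [Complex.norm_real, Real.norm_eq_abs, abs_of_pos (by positivity)] at h5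
      rw [inv_pow, ← mul_le_mul_iff_left₀ hgp, sub_mul, mul_assoc ‖c‖, inv_mul_cancel₀ hgp.ne',
        mul_one]
      exact h5
    have hlim : Filter.Tendsto (fun m : ℕ => (r + 2 * s) ^ n - ‖c‖ * (γ⁻¹) ^ m) Filter.atTop
        (nhds ((r + 2 * s) ^ n - ‖c‖ * 0)) :=
      ((tendsto_pow_atTop_nhds_zero_of_lt_one (by positivity)
        (inv_lt_one_of_one_lt₀ hγ)).const_mul _).const_sub _
    simpa using le_of_tendsto hlim hle
  by_contra hlt2
  rw [not_le] at hlt2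
  have hx : 1 < (r + 2 * s) / ρ := (one_lt_div hρ0).2 hlt2
  obtain ⟨n, hn⟩ := pow_unbounded_of_one_lt C hx
  rw [div_pow, lt_div_iff₀ (pow_pos hρ0 n)] at hn
  exact absurd (key n) (not_le.2 hn)
end

section
/- Let p,q,r ∈ [0,1] with p+q+r = 1 and 0 < q < p, let a ∈ (0,1), and let P be the birth-and-death stochastic matrix on ℕ with P(0,0)=a, P(0,1)=1−a and, for n ≥ 1, P(n,n−1)=p, P(n,n)=r, P(n,n+1)=q. Set γ̂ := √(p/q), V_γ̂(n) := γ̂^n, a₀ := 1−q−√(pq), a₁ := p − √(pq) − √(r(r+2√(pq))), and let π be an invariant probability distribution of P with ∑_n π(n) γ̂^n < ∞. Suppose a ∈ (0,a₀]. Then P is V_γ̂-geometrically ergodic and: (a) if 2p ≤ (1−q+√(pq))², then ρ_{V_γ̂}(P) = r + 2√(pq); (b) if 2p > (1−q+√(pq))², then ρ_{V_γ̂}(P) = |a + p(1−a)/(a−1+q)| when a ∈ (0,a₁], and ρ_{V_γ̂}(P) = r + 2√(pq) when a ∈ [a₁,a₀). -/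
namespace BD

lemma le_of_pow_le {x y C : ℝ} (hy : 0 < y) (h : ∀ n : ℕ, x ^ n ≤ C * y ^ n) : x ≤ y := by
  by_contra hlt
  push Not at hlt
  have h1 : 1 < x / y := by rwa [one_lt_div hy]
  obtain ⟨n, hn⟩ := pow_unbounded_of_one_lt C h1
  have h2 := h n
  rw [div_pow, lt_div_iff₀ (pow_pos hy n)] at hn
  linarith

lemma poly_absorb {x y : ℝ} (hx : 0 < x) (hxy : x < y) :
    ∃ D : ℝ, 0 < D ∧ ∀ n : ℕ, (2 * (n : ℝ) + 1) * x ^ n ≤ D * y ^ n := by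
  set d := y / x - 1 with hd
  have hd0 : 0 < d := by
    have : 1 < y / x := by rwa [one_lt_div hx]
    linarith
  refine ⟨1 + 2 / d, by positivity, fun n => ?_⟩
  have hb : 1 + (n : ℝ) * d ≤ (1 + d) ^ n := one_add_mul_le_pow (by linarith) n
  have hy : y = (1 + d) * x := by rw [hd]; field_simp; ring
  rw [hy, mul_pow, ← mul_assoc]
  refine mul_le_mul_of_nonneg_right ?_ (by positivity)
  calc 2 * (n : ℝ) + 1 ≤ (1 + 2 / d) * (1 + n * d) := by
        have : (1 + 2 / d) * (1 + n * d) = 1 + n * d + 2 / d + 2 * n := by field_simp; ring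
        rw [this]
        have : 0 ≤ n * d := by positivity
        have : 0 ≤ 2 / d := by positivity
        linarith
    _ ≤ _ := mul_le_mul_of_nonneg_left hb (by positivity)

lemma act_zero {P : ℕ → ℕ → ℝ} {a : ℝ}
    (hP00 : P 0 0 = a) (hP01 : P 0 1 = 1 - a) (hP0 : ∀ j, 2 ≤ j → P 0 j = 0) (f : ℕ → ℂ) :
    matActC P f 0 = (a : ℂ) * f 0 + (1 - (a : ℂ)) * f 1 := by
  unfold matActC
  rw [tsum_eq_sum (s := Finset.range 2)]
  · simp [Finset.sum_range_succ, hP00, hP01]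
  · intro j hj
    rw [hP0 j (by simp at hj; omega)]; simp

lemma act_succ {P : ℕ → ℕ → ℝ} {p q r : ℝ}
    (hPn : ∀ n : ℕ, 1 ≤ n →
      P n (n - 1) = p ∧ P n n = r ∧ P n (n + 1) = q ∧
      ∀ j, j ≠ n - 1 → j ≠ n → j ≠ n + 1 → P n j = 0) (f : ℕ → ℂ) (m : ℕ) :
    matActC P f (m + 1) = (p : ℂ) * f m + (r : ℂ) * f (m + 1) + (q : ℂ) * f (m + 2) := by
  obtain ⟨h1, h2, h3, h4⟩ := hPn (m + 1) (by omega)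
  simp only [Nat.add_sub_cancel] at h1 h4
  unfold matActC
  rw [tsum_eq_sum (s := {m, m + 1, m + 2})]
  · rw [Finset.sum_insert (by simp), Finset.sum_insert (by simp), Finset.sum_singleton,
      h1, h2, h3]
    ring
  · intro j hj
    simp only [Finset.mem_insert, Finset.mem_singleton, not_or] at hj
    rw [h4 j hj.1 hj.2.1 hj.2.2]; simp

/-- Detailed balance. -/
lemma balance {P : ℕ → ℕ → ℝ} {p q r a : ℝ} (hsum : p + q + r = 1)
    (hP00 : P 0 0 = a) (hP01 : P 0 1 = 1 - a) (hP0 : ∀ j, 2 ≤ j → P 0 j = 0)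
    (hPn : ∀ n : ℕ, 1 ≤ n →
      P n (n - 1) = p ∧ P n n = r ∧ P n (n + 1) = q ∧
      ∀ j, j ≠ n - 1 → j ≠ n → j ≠ n + 1 → P n j = 0)
    (π : ℕ → ℝ) (hπinv : ∀ j, ∑' i, π i * P i j = π j) :
    (1 - a) * π 0 = p * π 1 ∧ ∀ n, q * π (n + 1) = p * π (n + 2) := by
  have hz : ∀ i j, i ≠ j → i ≠ j + 1 → i + 1 ≠ j → P i j = 0 := by
    intro i j h1 h2 h3
    rcases Nat.eq_zero_or_pos i with h | h
    · subst h; exact hP0 j (by omega)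
    · exact (hPn i h).2.2.2 j (by omega) (by omega) (by omega)
  have hlow : ∀ i, P (i + 1) i = p := fun i => by simpa using (hPn (i + 1) (by omega)).1
  have hdiag : ∀ i, P (i + 1) (i + 1) = r := fun i => (hPn (i + 1) (by omega)).2.1
  have hup : ∀ i, P (i + 1) (i + 2) = q := fun i => (hPn (i + 1) (by omega)).2.2.1
  have e0 : a * π 0 + p * π 1 = π 0 := by
    have := hπinv 0
    rw [tsum_eq_sum (s := {0, 1})] at this
    · rw [Finset.sum_insert (by simp), Finset.sum_singleton, hP00, hlow 0] at this; linarith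
    · intro i hi
      simp only [Finset.mem_insert, Finset.mem_singleton, not_or] at hi
      rw [hz i 0 (by omega) (by omega) (by omega)]; simp
  have ej : ∀ j, π j * P j (j + 1) + r * π (j + 1) + p * π (j + 2) = π (j + 1) := by
    intro j
    have := hπinv (j + 1)
    rw [tsum_eq_sum (s := {j, j + 1, j + 2})] at this
    · rw [Finset.sum_insert (by simp), Finset.sum_insert (by simp), Finset.sum_singleton,
        hdiag j, hlow (j + 1)] at this
      linarith
    · intro i hi
      simp only [Finset.mem_insert, Finset.mem_singleton, not_or] at hi
      rw [hz i (j + 1) (by omega) (by omega) (by omega)]; simp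
  have b0 : (1 - a) * π 0 = p * π 1 := by linarith
  refine ⟨b0, fun n => ?_⟩
  have hr : r = 1 - p - q := by linarith
  induction n with
  | zero =>
    have := ej 0
    simp only [Nat.zero_add] at this ⊢
    rw [hP01] at this
    rw [hr] at this
    linarith
  | succ n ih =>
    have := ej (n + 1)
    rw [hup n, hr] at this
    linarith

lemma inv_act {P : ℕ → ℕ → ℝ} {p q r a G : ℝ} (hsum : p + q + r = 1)
    (hP00 : P 0 0 = a) (hP01 : P 0 1 = 1 - a) (hP0 : ∀ j, 2 ≤ j → P 0 j = 0)
    (hPn : ∀ n : ℕ, 1 ≤ n →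
      P n (n - 1) = p ∧ P n n = r ∧ P n (n + 1) = q ∧
      ∀ j, j ≠ n - 1 → j ≠ n → j ≠ n + 1 → P n j = 0)
    (π : ℕ → ℝ) (hπ0 : ∀ n, 0 ≤ π n) (hπinv : ∀ j, ∑' i, π i * P i j = π j)
    (hq : 0 ≤ q) (hπV : Summable (fun n => π n * G ^ n)) (f : ℕ → ℂ) (K L : ℝ)
    (hf : ∀ m, ‖f m‖ ≤ K * G ^ m) (hPf : ∀ m, ‖matActC P f m‖ ≤ L * G ^ m) :
    ∑' i, (π i : ℂ) * matActC P f i = ∑' i, (π i : ℂ) * f i := by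
  obtain ⟨b0, bn⟩ := balance hsum hP00 hP01 hP0 hPn π hπinv
  have hs : ∀ (h : ℕ → ℂ) (K : ℝ), (∀ m, ‖h m‖ ≤ K * G ^ m) →
      Summable (fun i => (π i : ℂ) * h i) := by
    intro h K hh
    refine Summable.of_norm_bounded (hπV.mul_left K) (fun i => ?_)
    rw [norm_mul, Complex.norm_real, Real.norm_of_nonneg (hπ0 i)]
    nlinarith [hh i, hπ0 i]
  have s1 := hs _ L hPf
  have s2 := hs _ K hf
  have hpart : ∀ N, ∑ i ∈ Finset.range (N + 2), ((π i : ℂ) * matActC P f i - (π i : ℂ) * f i)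
      = (q : ℂ) * π (N + 1) * (f (N + 2) - f (N + 1)) := by
    have b0' : (1 - (a : ℂ)) * π 0 = p * π 1 := by exact_mod_cast b0
    have bn' : ∀ n, (q : ℂ) * π (n + 1) = p * π (n + 2) := fun n => by exact_mod_cast bn n
    have hr : (r : ℂ) = 1 - p - q := by
      rw [show r = 1 - p - q by linarith]; push_cast; ring
    intro N
    induction N with
    | zero =>
      rw [Finset.sum_range_succ, Finset.sum_range_one, act_zero hP00 hP01 hP0,
        act_succ hPn f 0, hr]
      simp only [Nat.zero_add]
      linear_combination (f 1 - f 0) * b0'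
    | succ N ih =>
      rw [Finset.sum_range_succ, ih, act_succ hPn f (N + 1), hr]
      linear_combination (f (N + 2) - f (N + 1)) * bn' N
  have t1 : Filter.Tendsto (fun N => ∑ i ∈ Finset.range (N + 2),
      ((π i : ℂ) * matActC P f i - (π i : ℂ) * f i)) Filter.atTop
      (nhds (∑' i, ((π i : ℂ) * matActC P f i - (π i : ℂ) * f i))) :=
    (Filter.tendsto_add_atTop_iff_nat 2).mpr (s1.sub s2).hasSum.tendsto_sum_nat
  have t2 : Filter.Tendsto (fun N => ∑ i ∈ Finset.range (N + 2),
      ((π i : ℂ) * matActC P f i - (π i : ℂ) * f i)) Filter.atTop (nhds 0) := by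
    simp_rw [hpart]
    have t3 : Filter.Tendsto (fun N => q * K * (G + 1) * (π (N + 1) * G ^ (N + 1)))
        Filter.atTop (nhds 0) := by
      have := ((Filter.tendsto_add_atTop_iff_nat 1).mpr
        hπV.tendsto_atTop_zero).const_mul (q * K * (G + 1))
      simpa using this
    refine squeeze_zero_norm (fun N => ?_) t3
    rw [norm_mul, norm_mul, Complex.norm_real, Complex.norm_real, Real.norm_of_nonneg hq,
      Real.norm_of_nonneg (hπ0 _)]
    have h1 : ‖f (N + 2) - f (N + 1)‖ ≤ K * G ^ (N + 2) + K * G ^ (N + 1) :=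
      (norm_sub_le _ _).trans (add_le_add (hf _) (hf _))
    calc q * π (N + 1) * ‖f (N + 2) - f (N + 1)‖
        ≤ q * π (N + 1) * (K * G ^ (N + 2) + K * G ^ (N + 1)) :=
          mul_le_mul_of_nonneg_left h1 (mul_nonneg hq (hπ0 _))
      _ = _ := by ring
  have := tendsto_nhds_unique t1 t2
  rw [s1.tsum_sub s2] at this
  exact sub_eq_zero.mp this

/-- Key estimate: oscillation of the iterates. -/
lemma osc {p q r a G b l σ R : ℝ} (hq : 0 < q) (hG : 1 < G) (hp : p = q * G ^ 2)
    (hr0 : 0 ≤ r) (hsum : p + q + r = 1)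
    (hb : b * (a - 1 + q) = p) (hbG : |b| ≤ G)
    (hl : l = a - p + q * b) (hσ : σ = r + 2 * (q * G)) (hlR : |l| ≤ R) (hσR : σ ≤ R)
    (u : ℕ → ℕ → ℂ)
    (h0 : ∀ n, u (n + 1) 0 = (a : ℂ) * u n 0 + (1 - (a : ℂ)) * u n 1)
    (h1 : ∀ n m, u (n + 1) (m + 1) =
      (p : ℂ) * u n m + (r : ℂ) * u n (m + 1) + (q : ℂ) * u n (m + 2))
    (hu : ∀ m, ‖u 0 m‖ ≤ G ^ m) (n m : ℕ) :
    ‖u n m - u n 0‖ ≤ (2 + 4 * G ^ 2 / (G - 1)) * ((2 * n + 1) * R ^ n) * G ^ m := by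
  have hG0 : 0 < G := by linarith
  have hp0 : 0 < p := by rw [hp]; positivity
  have hσ0 : 0 < σ := by rw [hσ]; positivity
  have hR0 : 0 < R := by linarith
  have hqR : q ≤ R := by nlinarith
  have hq_n : ‖(q : ℂ)‖ = q := by rw [Complex.norm_real, Real.norm_of_nonneg hq.le]
  have hp_n : ‖(p : ℂ)‖ = p := by rw [Complex.norm_real, Real.norm_of_nonneg hp0.le]
  have hr_n : ‖(r : ℂ)‖ = r := by rw [Complex.norm_real, Real.norm_of_nonneg hr0]
  have hb_n : ‖(b : ℂ)‖ = |b| := by rw [Complex.norm_real, Real.norm_eq_abs]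
  have hl_n : ‖(l : ℂ)‖ = |l| := by rw [Complex.norm_real, Real.norm_eq_abs]
  have hbC : (b : ℂ) * (a - 1 + q) = p := by exact_mod_cast hb
  have hlC : (l : ℂ) = a - p + q * b := by exact_mod_cast hl
  have hrC : (r : ℂ) = 1 - p - q := by
    rw [show r = 1 - p - q by linarith]; push_cast; ring
  have tri : ∀ x y z : ℂ, ‖(p : ℂ) * x + r * y + q * z‖ ≤ p * ‖x‖ + r * ‖y‖ + q * ‖z‖ := by
    intro x y z
    refine (norm_add₃_le).trans ?_
    rw [norm_mul, norm_mul, norm_mul, hp_n, hr_n, hq_n]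
  set w : ℕ → ℕ → ℂ := fun n m => u n (m + 1) - u n m with hw
  set g : ℕ → ℕ → ℂ := fun n m => w n (m + 1) - b * w n m with hg
  have w0 : ∀ n, w (n + 1) 0 = l * w n 0 + q * g n 0 := by
    intro n
    simp only [hg, hw, h0, h1, hlC, hrC, Nat.zero_add]
    ring
  have g0 : ∀ n, g (n + 1) 0 = r * g n 0 + q * g n 1 := by
    intro n
    simp only [hg, hw, h0, h1, hrC, Nat.zero_add]
    linear_combination (-(u n 1 - u n 0)) * hbC
  have g1 : ∀ n m, g (n + 1) (m + 1) = p * g n m + r * g n (m + 1) + q * g n (m + 2) := by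
    intro n m
    simp only [hg, hw, h1]
    ring
  set K := 4 * G ^ 2 with hK
  have hK0 : 0 < K := by positivity
  have wb0 : ∀ m, ‖w 0 m‖ ≤ 2 * G * G ^ m := by
    intro m
    calc ‖w 0 m‖ ≤ G ^ (m + 1) + G ^ m := (norm_sub_le _ _).trans (add_le_add (hu _) (hu _))
      _ ≤ _ := by
        have : 0 < G ^ m := by positivity
        rw [pow_succ]; nlinarith
  have gb : ∀ n m, ‖g n m‖ ≤ K * σ ^ n * G ^ m := by
    intro n
    induction n with
    | zero =>
      intro m
      have h2 : ‖g 0 m‖ ≤ ‖w 0 (m + 1)‖ + |b| * ‖w 0 m‖ := by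
        refine (norm_sub_le _ _).trans ?_
        rw [norm_mul, hb_n]
      have h3 := wb0 (m + 1)
      have h4 : |b| * ‖w 0 m‖ ≤ G * (2 * G * G ^ m) :=
        mul_le_mul hbG (wb0 m) (norm_nonneg _) hG0.le
      rw [pow_succ] at h3
      rw [hK, pow_zero]
      linarith
    | succ n ih =>
      intro m
      cases m with
      | zero =>
        rw [g0]
        have i0 := ih 0
        have i1 := ih 1
        rw [pow_zero, mul_one] at i0
        rw [pow_one] at i1
        have h2 : ‖(r : ℂ) * g n 0 + q * g n 1‖ ≤ r * ‖g n 0‖ + q * ‖g n 1‖ := by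
          refine (norm_add_le _ _).trans ?_
          rw [norm_mul, norm_mul, hr_n, hq_n]
        have h3 := mul_le_mul_of_nonneg_left i0 hr0
        have h4 := mul_le_mul_of_nonneg_left i1 hq.le
        have h5 : 0 ≤ K * σ ^ n * (q * G) := by positivity
        have h6 : K * σ ^ (n + 1) * G ^ 0 = K * σ ^ n * (r + 2 * (q * G)) := by
          rw [pow_succ, ← hσ]; ring
        rw [h6]
        linarith
      | succ m =>
        rw [g1]
        have h3 := mul_le_mul_of_nonneg_left (ih m) hp0.le
        have h4 := mul_le_mul_of_nonneg_left (ih (m + 1)) hr0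
        have h5 := mul_le_mul_of_nonneg_left (ih (m + 2)) hq.le
        have h6 : K * σ ^ (n + 1) * G ^ (m + 1) = p * (K * σ ^ n * G ^ m)
            + r * (K * σ ^ n * G ^ (m + 1)) + q * (K * σ ^ n * G ^ (m + 2)) := by
          rw [pow_succ σ, hp]
          nth_rewrite 2 [hσ]
          ring
        rw [h6]
        linarith [tri (g n m) (g n (m + 1)) (g n (m + 2))]
  have gb' : ∀ n m, ‖g n m‖ ≤ K * R ^ n * G ^ m := by
    intro n m
    refine (gb n m).trans ?_
    gcongr
  have wz : ∀ n : ℕ, ‖w n 0‖ ≤ K * (n + 1) * R ^ n := by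
    intro n
    induction n with
    | zero =>
      have := wb0 0
      simp only [pow_zero, mul_one, Nat.cast_zero, zero_add, hK] at this ⊢
      nlinarith
    | succ n ih =>
      rw [w0]
      have h2 : ‖(l : ℂ) * w n 0 + q * g n 0‖ ≤ |l| * ‖w n 0‖ + q * ‖g n 0‖ := by
        refine (norm_add_le _ _).trans ?_
        rw [norm_mul, norm_mul, hl_n, hq_n]
      have h3 : |l| * ‖w n 0‖ ≤ R * (K * (n + 1) * R ^ n) :=
        mul_le_mul hlR ih (norm_nonneg _) hR0.le
      have h4 : q * ‖g n 0‖ ≤ R * (K * R ^ n * G ^ 0) :=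
        mul_le_mul hqR (gb' n 0) (norm_nonneg _) hR0.le
      have h5 : K * ((n + 1 : ℕ) + 1) * R ^ (n + 1) =
          R * (K * (n + 1) * R ^ n) + R * (K * R ^ n * G ^ 0) := by
        push_cast; ring
      rw [h5]; linarith
  have wm : ∀ n m : ℕ, ‖w n m‖ ≤ K * (n + 1 + m) * R ^ n * G ^ m := by
    intro n m
    induction m with
    | zero => simpa using wz n
    | succ m ih =>
      have h2 : w n (m + 1) = b * w n m + g n m := by simp only [hg]; ring
      have h3 : ‖w n (m + 1)‖ ≤ |b| * ‖w n m‖ + ‖g n m‖ := by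
        rw [h2]
        refine (norm_add_le _ _).trans ?_
        rw [norm_mul, hb_n]
      have h4 : |b| * ‖w n m‖ ≤ G * (K * (n + 1 + m) * R ^ n * G ^ m) :=
        mul_le_mul hbG ih (norm_nonneg _) hG0.le
      have h5 : K * R ^ n * G ^ m ≤ K * R ^ n * G ^ m * G :=
        le_mul_of_one_le_right (by positivity) hG.le
      have h6 : K * (n + 1 + (m + 1 : ℕ)) * R ^ n * G ^ (m + 1) =
          G * (K * (n + 1 + m) * R ^ n * G ^ m) + K * R ^ n * G ^ m * G := by
        push_cast; ring
      rw [h6]; linarith [gb' n m]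
  have hG1 : 0 < G - 1 := by linarith
  have um : ∀ n m : ℕ, ‖u n m - u n 0‖ ≤ K / (G - 1) * ((n + 1 + m) * R ^ n) * G ^ m := by
    intro n m
    induction m with
    | zero => simp; positivity
    | succ m ih =>
      have h2 : u n (m + 1) - u n 0 = (u n m - u n 0) + w n m := by simp only [hw]; ring
      have h3 : ‖u n (m + 1) - u n 0‖ ≤ ‖u n m - u n 0‖ + ‖w n m‖ := by
        rw [h2]; exact norm_add_le _ _
      have h4 : K / (G - 1) * ((n + 1 + m) * R ^ n) * G ^ m + K * (n + 1 + m) * R ^ n * G ^ m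
          = K / (G - 1) * ((n + 1 + m) * R ^ n) * G ^ (m + 1) := by
        rw [pow_succ]; field_simp; ring
      have h5 : K / (G - 1) * ((n + 1 + m) * R ^ n) * G ^ (m + 1) ≤
          K / (G - 1) * ((n + 1 + (m + 1 : ℕ)) * R ^ n) * G ^ (m + 1) := by
        push_cast; gcongr; linarith
      linarith [wm n m]
  have ufree : ∀ n m : ℕ, n ≤ m → ‖u n m‖ ≤ σ ^ n * G ^ m := by
    intro n
    induction n with
    | zero => intro m _; simpa using hu m
    | succ n ih =>
      intro m hm
      obtain ⟨m, rfl⟩ : ∃ k, m = k + 1 := ⟨m - 1, by omega⟩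
      rw [h1]
      have h3 := mul_le_mul_of_nonneg_left (ih m (by omega)) hp0.le
      have h4 := mul_le_mul_of_nonneg_left (ih (m + 1) (by omega)) hr0
      have h5 := mul_le_mul_of_nonneg_left (ih (m + 2) (by omega)) hq.le
      have h6 : σ ^ (n + 1) * G ^ (m + 1) = p * (σ ^ n * G ^ m)
          + r * (σ ^ n * G ^ (m + 1)) + q * (σ ^ n * G ^ (m + 2)) := by
        rw [pow_succ σ, hp]
        nth_rewrite 2 [hσ]
        ring
      rw [h6]
      linarith [tri (u n m) (u n (m + 1)) (u n (m + 2))]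
  have small : ∀ k : ℕ, k ≤ n →
      ‖u n k - u n 0‖ ≤ K / (G - 1) * ((2 * n + 1) * R ^ n) * G ^ k := by
    intro k hk
    refine (um n k).trans ?_
    have : (k : ℝ) ≤ n := by exact_mod_cast hk
    have h8 : (n : ℝ) + 1 + k ≤ 2 * n + 1 := by linarith
    gcongr
  rcases le_or_gt m n with hmn | hmn
  · refine (small m hmn).trans ?_
    gcongr
    linarith
  · have e : u n m - u n 0 = u n m - u n n + (u n n - u n 0) := by ring
    have hGm : G ^ n ≤ G ^ m := pow_le_pow_right₀ hG.le hmn.le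
    have hσn : σ ^ n ≤ R ^ n := pow_le_pow_left₀ hσ0.le hσR n
    have t1 : ‖u n m‖ ≤ R ^ n * G ^ m := (ufree n m hmn.le).trans (by gcongr)
    have t2 : ‖u n n‖ ≤ R ^ n * G ^ m := (ufree n n le_rfl).trans (by gcongr)
    have t3 : ‖u n n - u n 0‖ ≤ K / (G - 1) * ((2 * n + 1) * R ^ n) * G ^ m :=
      (small n le_rfl).trans (by gcongr)
    have t4 : R ^ n * G ^ m ≤ (2 * n + 1) * R ^ n * G ^ m := by
      have : (1 : ℝ) ≤ 2 * n + 1 := by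
        have : (0 : ℝ) ≤ n := Nat.cast_nonneg n
        linarith
      have h7 : 0 < R ^ n * G ^ m := by positivity
      nlinarith
    calc ‖u n m - u n 0‖ ≤ ‖u n m‖ + ‖u n n‖ + ‖u n n - u n 0‖ := by
          rw [e]
          exact (norm_add_le _ _).trans (add_le_add (norm_sub_le _ _) le_rfl)
      _ ≤ 2 * ((2 * n + 1) * R ^ n * G ^ m) + K / (G - 1) * ((2 * n + 1) * R ^ n) * G ^ m := by
          linarith
      _ = _ := by ring

set_option maxHeartbeats 1000000 in
/-- The rate is always `max |λ| σ`. -/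
lemma rate {p q r a G b l σ : ℝ} (hq : 0 < q) (hG : 1 < G) (hp : p = q * G ^ 2)
    (hr0 : 0 ≤ r) (hsum : p + q + r = 1) (ha0 : 0 < a) (ha1 : a < 1)
    (hb : b * (a - 1 + q) = p) (hb0 : b ≤ 0) (hbG : |b| ≤ G)
    (hl : l = a - p + q * b) (hσ : σ = r + 2 * (q * G)) (hl1 : |l| < 1)
    (P : ℕ → ℕ → ℝ)
    (hP00 : P 0 0 = a) (hP01 : P 0 1 = 1 - a) (hP0 : ∀ j, 2 ≤ j → P 0 j = 0)
    (hPn : ∀ n : ℕ, 1 ≤ n →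
      P n (n - 1) = p ∧ P n n = r ∧ P n (n + 1) = q ∧
      ∀ j, j ≠ n - 1 → j ≠ n → j ≠ n + 1 → P n j = 0)
    (π : ℕ → ℝ) (hπ0 : ∀ n, 0 ≤ π n) (hπsum : HasSum π 1)
    (hπinv : ∀ j, ∑' i, π i * P i j = π j)
    (hπV : Summable (fun n => π n * G ^ n)) :
    (ergSet P π (fun n => G ^ n)).Nonempty ∧
      sInf (ergSet P π (fun n => G ^ n)) = max |l| σ := by
  have hG0 : 0 < G := by linarith
  have hp0 : 0 < p := by rw [hp]; positivity
  have hσ0 : 0 < σ := by rw [hσ]; positivity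
  have hσ1 : σ < 1 := by
    have : 0 < q * (G - 1) ^ 2 := mul_pos hq (pow_pos (by linarith) 2)
    nlinarith
  set R := max |l| σ with hR
  have hR0 : 0 < R := lt_of_lt_of_le hσ0 (le_max_right _ _)
  have hR1 : R < 1 := max_lt hl1 hσ1
  have iter0 : ∀ f n, (matActC P)^[n + 1] f 0 =
      (a : ℂ) * (matActC P)^[n] f 0 + (1 - (a : ℂ)) * (matActC P)^[n] f 1 := by
    intro f n
    rw [Function.iterate_succ_apply', act_zero hP00 hP01 hP0]
  have iter1 : ∀ f n m, (matActC P)^[n + 1] f (m + 1) =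
      (p : ℂ) * (matActC P)^[n] f m + (r : ℂ) * (matActC P)^[n] f (m + 1)
        + (q : ℂ) * (matActC P)^[n] f (m + 2) := by
    intro f n m
    rw [Function.iterate_succ_apply', act_succ hPn]
  have hq_n : ‖(q : ℂ)‖ = q := by rw [Complex.norm_real, Real.norm_of_nonneg hq.le]
  have hp_n : ‖(p : ℂ)‖ = p := by rw [Complex.norm_real, Real.norm_of_nonneg hp0.le]
  have hr_n : ‖(r : ℂ)‖ = r := by rw [Complex.norm_real, Real.norm_of_nonneg hr0]
  have ha_n : ‖(a : ℂ)‖ = a := by rw [Complex.norm_real, Real.norm_of_nonneg ha0.le]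
  have ha_n' : ‖(1 - a : ℂ)‖ = 1 - a := by
    rw [← Complex.ofReal_one, ← Complex.ofReal_sub, Complex.norm_real,
      Real.norm_of_nonneg (by linarith)]
  -- crude bound of the action
  have crude : ∀ (f : ℕ → ℂ) (K : ℝ), 0 ≤ K → (∀ m, ‖f m‖ ≤ K * G ^ m) →
      ∀ m, ‖matActC P f m‖ ≤ ((a + (1 - a) * G + σ) * K) * G ^ m := by
    intro f K hK hf m
    have ha' : 0 < 1 - a := by linarith
    cases m with
    | zero =>
      rw [act_zero hP00 hP01 hP0]
      have h2 : ‖(a : ℂ) * f 0 + (1 - (a : ℂ)) * f 1‖ ≤ a * ‖f 0‖ + (1 - a) * ‖f 1‖ := by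
        refine (norm_add_le _ _).trans ?_
        rw [norm_mul, norm_mul, ha_n, ha_n']
      have h3 := mul_le_mul_of_nonneg_left (hf 0) ha0.le
      have h4 := mul_le_mul_of_nonneg_left (hf 1) ha'.le
      have h5 : 0 ≤ σ * K := by positivity
      simp only [pow_zero, pow_one, mul_one] at h3 h4 ⊢
      nlinarith
    | succ m =>
      rw [act_succ hPn]
      have h2 : ‖(p : ℂ) * f m + r * f (m + 1) + q * f (m + 2)‖
          ≤ p * ‖f m‖ + r * ‖f (m + 1)‖ + q * ‖f (m + 2)‖ := by
        refine (norm_add₃_le).trans ?_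
        rw [norm_mul, norm_mul, norm_mul, hp_n, hr_n, hq_n]
      have h3 := mul_le_mul_of_nonneg_left (hf m) hp0.le
      have h4 := mul_le_mul_of_nonneg_left (hf (m + 1)) hr0
      have h5 := mul_le_mul_of_nonneg_left (hf (m + 2)) hq.le
      have h6 : p * (K * G ^ m) + r * (K * G ^ (m + 1)) + q * (K * G ^ (m + 2))
          = (σ * K) * G ^ (m + 1) := by
        rw [hp, hσ]; ring
      have h7 : 0 ≤ ((a + (1 - a) * G) * K) * G ^ (m + 1) := by positivity
      nlinarith
  have iterb : ∀ (f : ℕ → ℂ), (∀ m, ‖f m‖ ≤ G ^ m) → ∀ n, ∃ K : ℝ, 0 ≤ K ∧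
      ∀ m, ‖(matActC P)^[n] f m‖ ≤ K * G ^ m := by
    intro f hf n
    have ha' : 0 < 1 - a := by linarith
    induction n with
    | zero => exact ⟨1, by norm_num, fun m => by simpa using hf m⟩
    | succ n ih =>
      obtain ⟨K, hK, h⟩ := ih
      refine ⟨(a + (1 - a) * G + σ) * K, by positivity, fun m => ?_⟩
      · rw [Function.iterate_succ_apply']
        exact crude _ K hK h m
  have hinv : ∀ (f : ℕ → ℂ), (∀ m, ‖f m‖ ≤ G ^ m) → ∀ n,
      ∑' i, (π i : ℂ) * (matActC P)^[n] f i = ∑' i, (π i : ℂ) * f i := by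
    intro f hf n
    induction n with
    | zero => rfl
    | succ n ih =>
      obtain ⟨K, hK, h⟩ := iterb f hf n
      rw [← ih]
      simp only [Function.iterate_succ_apply']
      exact inv_act hsum hP00 hP01 hP0 hPn π hπ0 hπinv hq.le hπV _ K _ h (crude _ K hK h)
  set S := ∑' i, π i * G ^ i with hS
  have hS0 : 0 ≤ S := tsum_nonneg (fun i => mul_nonneg (hπ0 i) (by positivity))
  have sπ : ∀ (h : ℕ → ℂ) (K : ℝ), (∀ m, ‖h m‖ ≤ K * G ^ m) →
      Summable (fun i => (π i : ℂ) * h i) ∧ ‖∑' i, (π i : ℂ) * h i‖ ≤ K * S := by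
    intro h K hh
    have hbd : ∀ i, ‖(π i : ℂ) * h i‖ ≤ K * (π i * G ^ i) := by
      intro i
      rw [norm_mul, Complex.norm_real, Real.norm_of_nonneg (hπ0 i)]
      nlinarith [hh i, hπ0 i]
    exact ⟨Summable.of_norm_bounded (hπV.mul_left K) hbd,
      tsum_of_norm_bounded (hπV.hasSum.mul_left K) hbd⟩
  have hπC : HasSum (fun i => (π i : ℂ)) 1 := by
    simpa using (Complex.hasSum_ofReal (f := π) (x := 1)).mpr hπsum
  -- upper bound
  have upper : ∀ ρ, R < ρ → ρ < 1 → ρ ∈ ergSet P π (fun n => G ^ n) := by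
    intro ρ hρ hρ1
    obtain ⟨D, hD, hDn⟩ := poly_absorb hR0 hρ
    have hG1 : 0 < G - 1 := by linarith
    set M := 2 + 4 * G ^ 2 / (G - 1) with hM
    have hM0 : 0 < M := by positivity
    refine ⟨hR0.trans hρ, hρ1, M * (1 + S) * D, by positivity, fun n f hf m => ?_⟩
    have ho := osc hq hG hp hr0 hsum hb hbG hl hσ (le_max_left _ _) (le_max_right _ _)
      (fun n => (matActC P)^[n] f) (iter0 f) (iter1 f) hf n
    set u := (matActC P)^[n] f with hu
    rw [← hR, ← hM] at ho
    have hE0 : 0 ≤ M * ((2 * n + 1) * R ^ n) := by positivity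
    obtain ⟨s1, b1⟩ := sπ (fun i => u i - u 0) _ ho
    have e1 : ∑' i, (π i : ℂ) * f i = u 0 + ∑' i, (π i : ℂ) * (u i - u 0) := by
      rw [← hinv f hf n, ← hu]
      have h2 : HasSum (fun i => (π i : ℂ) * u 0 + (π i : ℂ) * (u i - u 0))
          (1 * u 0 + ∑' i, (π i : ℂ) * (u i - u 0)) := (hπC.mul_right (u 0)).add s1.hasSum
      rw [one_mul] at h2
      rw [← h2.tsum_eq]
      congr 1
      ext i
      ring
    have hGm : 1 ≤ G ^ m := one_le_pow₀ hG.le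
    calc ‖u m - ∑' i, (π i : ℂ) * f i‖
        = ‖(u m - u 0) - ∑' i, (π i : ℂ) * (u i - u 0)‖ := by rw [e1]; congr 1; ring
      _ ≤ M * ((2 * n + 1) * R ^ n) * G ^ m + M * ((2 * n + 1) * R ^ n) * S :=
          (norm_sub_le _ _).trans (add_le_add (ho m) b1)
      _ ≤ M * ((2 * n + 1) * R ^ n) * G ^ m + M * ((2 * n + 1) * R ^ n) * (S * G ^ m) := by
          gcongr
          exact le_mul_of_one_le_right hS0 hGm
      _ = M * (1 + S) * ((2 * n + 1) * R ^ n) * G ^ m := by ring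
      _ ≤ M * (1 + S) * (D * ρ ^ n) * G ^ m := by
          exact mul_le_mul_of_nonneg_right
            (mul_le_mul_of_nonneg_left (hDn n) (by positivity)) (by positivity)
      _ = _ := by ring
  -- lower bound
  have lower : ∀ ρ ∈ ergSet P π (fun n => G ^ n), R ≤ ρ := by
    rintro ρ ⟨hρ0, hρ1, C, hC, h⟩
    refine max_le ?_ ?_
    · have hbC : (b : ℂ) * (a - 1 + q) = p := by exact_mod_cast hb
      have hlC : (l : ℂ) = a - p + q * b := by exact_mod_cast hl
      have hrC : (r : ℂ) = 1 - p - q := by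
        rw [show r = 1 - p - q by linarith]; push_cast; ring
      have hf : ∀ m : ℕ, ‖(b : ℂ) ^ m‖ ≤ G ^ m := by
        intro m
        rw [norm_pow, Complex.norm_real, Real.norm_eq_abs]
        exact pow_le_pow_left₀ (abs_nonneg _) hbG m
      have hit : ∀ n m, (matActC P)^[n] (fun m => (b : ℂ) ^ m) m = (l : ℂ) ^ n * (b : ℂ) ^ m := by
        intro n
        induction n with
        | zero => intro m; simp
        | succ n ih =>
          intro m
          cases m with
          | zero =>
            rw [iter0, ih, ih, pow_succ, hlC]
            linear_combination (-(↑a - ↑p + ↑q * ↑b) ^ n) * hbC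
          | succ m =>
            rw [iter1, ih, ih, ih, pow_succ (l : ℂ), hrC]
            have : (p : ℂ) + (1 - p - q) * b + q * b ^ 2 = l * b := by
              rw [hlC]; linear_combination (-1) * hbC
            linear_combination ((l : ℂ) ^ n * (b : ℂ) ^ m) * this
      refine le_of_pow_le (C := C * (1 + G)) hρ0 (fun n => ?_)
      have k0 := h n (fun m => (b : ℂ) ^ m) hf 0
      have k1 := h n (fun m => (b : ℂ) ^ m) hf 1
      rw [hit] at k0 k1
      set X := ∑' i, (π i : ℂ) * (b : ℂ) ^ i
      have e : ((l ^ n * (1 - b) : ℝ) : ℂ)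
          = ((l : ℂ) ^ n * (b : ℂ) ^ 0 - X) - ((l : ℂ) ^ n * (b : ℂ) ^ 1 - X) := by
        push_cast; ring
      have e2 : |l| ^ n * (1 - b) ≤ C * ρ ^ n * G ^ 0 + C * ρ ^ n * G ^ 1 := by
        have : ‖((l ^ n * (1 - b) : ℝ) : ℂ)‖ ≤ C * ρ ^ n * G ^ 0 + C * ρ ^ n * G ^ 1 := by
          rw [e]; exact (norm_sub_le _ _).trans (add_le_add k0 k1)
        rwa [Complex.norm_real, Real.norm_eq_abs, abs_mul, abs_pow,
          abs_of_nonneg (by linarith : 0 ≤ 1 - b)] at this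
      have e3 : 0 ≤ |l| ^ n := by positivity
      nlinarith
    · refine le_of_pow_le (C := C) hρ0 (fun n => ?_)
      have hf : ∀ m : ℕ, ‖(G : ℂ) ^ m‖ ≤ G ^ m := by
        intro m
        rw [norm_pow, Complex.norm_real, Real.norm_of_nonneg hG0.le]
      have hit : ∀ n m, n ≤ m →
          (matActC P)^[n] (fun m => (G : ℂ) ^ m) m = (σ : ℂ) ^ n * (G : ℂ) ^ m := by
        intro n
        induction n with
        | zero => intro m _; simp
        | succ n ih =>
          intro m hm
          obtain ⟨m, rfl⟩ : ∃ k, m = k + 1 := ⟨m - 1, by omega⟩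
          rw [iter1, ih _ (by omega), ih _ (by omega), ih _ (by omega), pow_succ (σ : ℂ)]
          have : (p : ℂ) + r * G + q * G ^ 2 = σ * G := by
            rw [hp, hσ]; push_cast; ring
          linear_combination ((σ : ℂ) ^ n * (G : ℂ) ^ m) * this
      have hX := (sπ (fun m => (G : ℂ) ^ m) 1 (fun m => by simpa using hf m)).2
      rw [one_mul] at hX
      by_contra hlt
      push Not at hlt
      obtain ⟨k, hk⟩ := pow_unbounded_of_one_lt (S / (σ ^ n - C * ρ ^ n)) hG
      have hkm : G ^ k ≤ G ^ (k + n) := pow_le_pow_right₀ hG.le (by omega)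
      have hd : 0 < σ ^ n - C * ρ ^ n := by linarith
      rw [div_lt_iff₀ hd] at hk
      have k0 := h n (fun m => (G : ℂ) ^ m) hf (k + n)
      rw [hit n _ (by omega)] at k0
      have k1 : σ ^ n * G ^ (k + n) ≤ C * ρ ^ n * G ^ (k + n) + S := by
        have e : ‖(σ : ℂ) ^ n * (G : ℂ) ^ (k + n)‖ = σ ^ n * G ^ (k + n) := by
          rw [norm_mul, norm_pow, norm_pow, Complex.norm_real, Complex.norm_real,
            Real.norm_of_nonneg hG0.le, Real.norm_of_nonneg hσ0.le]
        rw [← e]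
        have := norm_sub_norm_le ((σ : ℂ) ^ n * (G : ℂ) ^ (k + n)) (∑' i, (π i : ℂ) * (G : ℂ) ^ i)
        linarith
      have k2 : G ^ k * (σ ^ n - C * ρ ^ n) ≤ G ^ (k + n) * (σ ^ n - C * ρ ^ n) :=
        mul_le_mul_of_nonneg_right hkm hd.le
      linarith
  have hne : (ergSet P π (fun n => G ^ n)).Nonempty :=
    ⟨(R + 1) / 2, upper _ (by linarith) (by linarith)⟩
  refine ⟨hne, le_antisymm ?_ (le_csInf hne lower)⟩
  refine le_of_forall_gt_imp_ge_of_dense (fun ρ hρ => ?_)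
  have hm : R < min ρ ((R + 1) / 2) := lt_min hρ (by linarith)
  refine (csInf_le ⟨R, lower⟩ (upper _ hm ?_)).trans (min_le_left _ _)
  exact (min_le_right _ _).trans_lt (by linarith)

end BD

/-- for the birth-and-death chain with `0 < q < p` and boundary parameter
`a ∈ (0,a₀]` where `a₀ = 1 - q - √(pq)`, with `γ̂ = √(p/q)` and
`a₁ = p - √(pq) - √(r(r+2√(pq)))`, the chain is `V_γ̂`-geometrically ergodic and:
(a) if `2p ≤ (1-q+√(pq))²` then `ρ = r + 2√(pq)`;
(b) if `2p > (1-q+√(pq))²` then `ρ = |a + p(1-a)/(a-1+q)|` for `a ∈ (0,a₁]` and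
`ρ = r + 2√(pq)` for `a ∈ [a₁,a₀)`. -/
theorem bd_rate_small_a
    (p q r a : ℝ)
    (hp0 : 0 ≤ p) (hp1 : p ≤ 1) (hq1 : q ≤ 1) (hr0 : 0 ≤ r) (hr1 : r ≤ 1)
    (hsum : p + q + r = 1) (hq : 0 < q) (hqp : q < p)
    (ha0 : 0 < a) (ha1 : a < 1)
    (P : ℕ → ℕ → ℝ)
    (hP00 : P 0 0 = a) (hP01 : P 0 1 = 1 - a) (hP0 : ∀ j, 2 ≤ j → P 0 j = 0)
    (hPn : ∀ n : ℕ, 1 ≤ n →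
      P n (n - 1) = p ∧ P n n = r ∧ P n (n + 1) = q ∧
      ∀ j, j ≠ n - 1 → j ≠ n → j ≠ n + 1 → P n j = 0)
    (π : ℕ → ℝ) (hπ0 : ∀ n, 0 ≤ π n) (hπsum : HasSum π 1)
    (hπinv : ∀ j, ∑' i, π i * P i j = π j)
    (hπV : Summable (fun n => π n * Real.sqrt (p / q) ^ n))
    (haa0 : a ≤ 1 - q - Real.sqrt (p * q)) :
    (ergSet P π (fun n => Real.sqrt (p / q) ^ n)).Nonempty
    ∧ (2 * p ≤ (1 - q + Real.sqrt (p * q)) ^ 2 →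
        sInf (ergSet P π (fun n => Real.sqrt (p / q) ^ n)) = r + 2 * Real.sqrt (p * q))
    ∧ (2 * p > (1 - q + Real.sqrt (p * q)) ^ 2 →
        (a ≤ p - Real.sqrt (p * q) - Real.sqrt (r * (r + 2 * Real.sqrt (p * q))) →
          sInf (ergSet P π (fun n => Real.sqrt (p / q) ^ n))
            = |a + p * (1 - a) / (a - 1 + q)|)
        ∧ (p - Real.sqrt (p * q) - Real.sqrt (r * (r + 2 * Real.sqrt (p * q))) ≤ a →
            a < 1 - q - Real.sqrt (p * q) →
          sInf (ergSet P π (fun n => Real.sqrt (p / q) ^ n)) = r + 2 * Real.sqrt (p * q))) := by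
  
  set G := Real.sqrt (p / q) with hGdef
  have hppos : 0 < p := hq.trans hqp
  have hG : 1 < G := by
    rw [hGdef, Real.lt_sqrt (by norm_num)]
    rw [one_pow, one_lt_div hq]; exact hqp
  have hG0 : 0 < G := by linarith
  have hp : p = q * G ^ 2 := by
    rw [hGdef, Real.sq_sqrt (by positivity)]; field_simp
  have hs : Real.sqrt (p * q) = q * G := by
    rw [hp, show q * G ^ 2 * q = (q * G) ^ 2 by ring, Real.sqrt_sq (by positivity)]
  rw [hs] at haa0 ⊢
  set s := q * G with hsdef
  have hs0 : 0 < s := by positivity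
  have hsq : s ^ 2 = p * q := by rw [hp, hsdef]; ring
  have hqs : q < s := by rw [hsdef]; nlinarith
  have hsp : s < p := by rw [hp, hsdef]; nlinarith
  -- x = 1 - q - a
  set x := 1 - q - a with hx
  have hxs : s ≤ x := by linarith
  have hx0 : 0 < x := by linarith
  have hden : a - 1 + q = -x := by rw [hx]; ring
  set b := p / (a - 1 + q) with hbdef
  have hb : b * (a - 1 + q) = p := by
    rw [hbdef, hden]; field_simp
  have hbx : b = -(p / x) := by rw [hbdef, hden, div_neg]
  have hb0 : b ≤ 0 := by
    rw [hbx]; have : 0 < p / x := by positivity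
    linarith
  have hbG : |b| ≤ G := by
    rw [hbx, abs_neg, abs_of_nonneg (by positivity), div_le_iff₀ hx0]
    have : G * s ≤ G * x := by gcongr
    have : p = G * s := by rw [hp, hsdef]; ring
    linarith
  set l := a + p * (1 - a) / (a - 1 + q) with hldef
  have hl : l = a - p + q * b := by
    have : l = a + b * (1 - a) := by rw [hldef, hbdef]; ring
    rw [this]; linear_combination (-1) * hb
  have hr : r = 1 - p - q := by linarith
  -- |l| = x + s²/x - r
  have hlx : l * x = r * x - x ^ 2 - s ^ 2 := by
    have hbx' : b * x = -p := by rw [hbx]; field_simp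
    rw [hl, hsq, hr]
    have : a = 1 - q - x := by rw [hx]; ring
    rw [this]
    linear_combination q * hbx'
  have hl_up : l ≤ r - 2 * s := by
    have h2 : l * x ≤ (r - 2 * s) * x := by nlinarith [sq_nonneg (x - s)]
    exact le_of_mul_le_mul_right h2 hx0
  have hl1 : |l| < 1 := by
    rw [abs_lt]
    constructor
    · have h3 : a * (a - (p - q)) < r := by
        rcases lt_or_ge (a - (p - q)) 0 with hd | hd
        · have := mul_neg_of_pos_of_neg ha0 hd
          linarith
        · have : a * (a - (p - q)) ≤ 1 * (a - (p - q)) :=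
            mul_le_mul_of_nonneg_right ha1.le hd
          linarith
      have h2 : (-1) * x < l * x := by
        have : x = 1 - q - a := hx
        rw [hlx, hsq, this, hr]
        rw [hr] at h3
        nlinarith
      exact lt_of_mul_lt_mul_right h2 hx0.le
    · linarith
  obtain ⟨hne, hinf⟩ := BD.rate (σ := r + 2 * s) hq hG hp hr0 hsum ha0 ha1 hb hb0 hbG hl rfl hl1
    P hP00 hP01 hP0 hPn π hπ0 hπsum hπinv hπV
  set t := Real.sqrt (r * (r + 2 * s)) with ht
  have ht0 : 0 ≤ t := Real.sqrt_nonneg _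
  have htsq : t ^ 2 = r * (r + 2 * s) := Real.sq_sqrt (by positivity)
  have htr : r ≤ t := Real.le_sqrt_of_sq_le (by nlinarith)
  have hQ : (x - r - s - t) * (x - r - s + t) = (-l) * x - (r + 2 * s) * x := by
    linear_combination (-1) * htsq + hlx
  have big : p - s - t ≤ a → sInf (ergSet P π (fun n => G ^ n)) = r + 2 * s := by
    intro h
    rw [hinf]
    apply max_eq_right
    rw [abs_le]
    refine ⟨?_, by linarith⟩
    have h2 : (x - r - s - t) * (x - r - s + t) ≤ 0 :=
      mul_nonpos_of_nonpos_of_nonneg (by linarith) (by linarith)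
    have h3 : (-l) * x ≤ (r + 2 * s) * x := by linarith
    linarith [le_of_mul_le_mul_right h3 hx0]
  refine ⟨hne, fun h => big ?_, fun _ => ⟨fun h => ?_, fun h _ => big h⟩⟩
  · have h2 : p - s ≤ t := by
      apply Real.le_sqrt_of_sq_le
      have h4 : r * (r + 2 * s) - (p - s) ^ 2 = (1 - q + s) ^ 2 - 2 * p := by
        rw [hr]; linear_combination (-2) * hsq
      linarith
    linarith
  · rw [hinf]
    apply max_eq_left
    have h2 : 0 ≤ (x - r - s - t) * (x - r - s + t) :=
      mul_nonneg (by linarith) (by linarith)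
    have h3 : (r + 2 * s) * x ≤ (-l) * x := by linarith
    exact (le_of_mul_le_mul_right h3 hx0).trans (neg_le_abs l)
end

section
/- Let p ∈ (0,1), q = 1−p, and let (q_n)_{n≥1} ⊂ [0,1] with ∑_{n≥1} q_n = 1. Let P be the stochastic matrix on ℕ with P(0,n) = q_n for n ≥ 1, and P(n,0) = p, P(n,n+1) = q for n ≥ 1. Let γ ∈ (1,1/q) with ∑_{n≥1} q_n γ^n < ∞, set V_γ(n) := γ^n, and let π be an invariant probability distribution of P with ∑_n π(n) γ^n < ∞. Then P is V_γ-geometrically ergodic with ρ_{V_γ}(P) ≤ max(qγ, p); that is, for every ρ with max(qγ,p) < ρ < 1 there exists C > 0 such that for all n ∈ ℕ and all f with ‖f‖_{V_γ} ≤ 1, ‖P^n f − π(f)·1‖_{V_γ} ≤ C ρ^n. -/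
/-- for the non-reversible random walk with unbounded increments
(`P(0,n) = q_n`, `P(n,0) = p`, `P(n,n+1) = q = 1-p`), with `γ ∈ (1,1/q)` and
`∑ q_n γ^n < ∞`, the chain is `V_γ`-geometrically ergodic with rate
`ρ_{V_γ}(P) ≤ max(qγ, p)`. -/
theorem unbounded_rw_rate
    (p q : ℝ) (hp0 : 0 < p) (hp1 : p < 1) (hpq : q = 1 - p)
    (qseq : ℕ → ℝ)
    (hq01 : ∀ n, 1 ≤ n → 0 ≤ qseq n ∧ qseq n ≤ 1)
    (hqsum : HasSum (fun n : ℕ => qseq (n + 1)) 1)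
    (P : ℕ → ℕ → ℝ)
    (hP00 : P 0 0 = 0) (hP0 : ∀ n, 1 ≤ n → P 0 n = qseq n)
    (hPn : ∀ n : ℕ, 1 ≤ n → ∀ j, P n j = if j = 0 then p else if j = n + 1 then q else 0)
    (γ : ℝ) (hγ1 : 1 < γ) (hγq : γ < 1 / q)
    (hmom : Summable (fun n : ℕ => qseq (n + 1) * γ ^ (n + 1)))
    (π : ℕ → ℝ) (hπ0 : ∀ n, 0 ≤ π n) (hπsum : HasSum π 1)
    (hπinv : ∀ j, ∑' i, π i * P i j = π j)
    (hπV : Summable (fun n => π n * γ ^ n)) :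
    ∀ ρ : ℝ, max (q * γ) p < ρ → ρ < 1 →
      ∃ C : ℝ, 0 < C ∧ ∀ n : ℕ, ∀ f : ℕ → ℂ, (∀ m, ‖f m‖ ≤ γ ^ m) →
        ∀ m, ‖(matActC P)^[n] f m - ∑' i, (π i : ℂ) * f i‖ ≤ C * ρ ^ n * γ ^ m := by
  intro ρ hρ hρ1
  have hqp : 0 < q := by linarith
  have hρ₁ : q * γ < ρ := lt_of_le_of_lt (le_max_left _ _) hρ
  have hρ₂ : p < ρ := lt_of_le_of_lt (le_max_right _ _) hρ
  have hρ0 : 0 < ρ := hp0.trans hρ₂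
  have hγ0 : 0 < γ := by linarith
  have hqγ0 : 0 < q * γ := mul_pos hqp hγ0
  -- action of P
  have act0 : ∀ g : ℕ → ℂ, matActC P g 0 = ∑' k, (qseq (k + 1) : ℂ) * g (k + 1) := by
    intro g
    unfold matActC
    have hinj : Function.Injective (fun k : ℕ => k + 1) := fun a b h => by simpa using h
    rw [← hinj.tsum_eq (f := fun j => (P 0 j : ℂ) * g j)]
    · refine tsum_congr fun k => ?_
      simp only [hP0 (k + 1) (by omega)]
    · intro j hj
      rcases j with _ | j
      · simp [hP00] at hj
      · exact ⟨j, rfl⟩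
  have act1 : ∀ g : ℕ → ℂ, ∀ m, 1 ≤ m → matActC P g m = p * g 0 + q * g (m + 1) := by
    intro g m hm
    unfold matActC
    rw [tsum_eq_sum (s := {0, m + 1})]
    · rw [Finset.sum_pair (by omega)]
      simp [hPn m hm]
    · intro b hb
      simp only [Finset.mem_insert, Finset.mem_singleton, not_or] at hb
      simp [hPn m hm, hb.1, hb.2]
  -- invariant measure
  have pi0 : p * (1 - π 0) = π 0 := by
    have h1 : HasSum (fun i => p * π i - (if i = 0 then p * π 0 else 0)) (p * 1 - p * π 0) :=
      (hπsum.mul_left p).sub (hasSum_ite_eq 0 (p * π 0))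
    have h2 : (fun i => p * π i - (if i = 0 then p * π 0 else 0)) = fun i => π i * P i 0 := by
      funext i
      rcases i with _ | i
      · simp [hP00]
      · simp [hPn (i + 1) (by omega), mul_comm]
    rw [h2] at h1
    have := h1.tsum_eq
    rw [hπinv 0] at this
    linarith
  have pi1 : π 1 = π 0 * qseq 1 := by
    rw [← hπinv 1, tsum_eq_single 0]
    · rw [hP0 1 le_rfl]
    · intro b hb
      rw [hPn b (by omega)]
      simp [hb]
  have pi2 : ∀ m, π (m + 2) = π 0 * qseq (m + 2) + q * π (m + 1) := by
    intro m
    rw [← hπinv (m + 2), tsum_eq_sum (s := {0, m + 1})]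
    · rw [Finset.sum_pair (by omega), hP0 (m + 2) (by omega), hPn (m + 1) (by omega)]
      simp [mul_comm]
    · intro b hb
      simp only [Finset.mem_insert, Finset.mem_singleton, not_or] at hb
      rw [hPn b (by omega), if_neg (by omega), if_neg (by omega), mul_zero]
  have hπ01 : 0 ≤ 1 - π 0 := by
    have := hπ0 0
    by_contra h
    nlinarith
  set M : ℝ := ∑' k, qseq (k + 1) * γ ^ (k + 1) with hM
  have hπV' : Summable (fun n => π (n + 1) * γ ^ (n + 1)) :=
    (summable_nat_add_iff (f := fun n => π n * γ ^ n) 1).2 hπV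
  set B : ℝ := ∑' k, π (k + 1) * γ ^ (k + 1) with hB
  have hM0 : 0 ≤ M := tsum_nonneg fun k => mul_nonneg (hq01 _ (by omega)).1 (by positivity)
  have hB0 : 0 ≤ B := tsum_nonneg fun k => mul_nonneg (hπ0 _) (by positivity)
  -- generic bounds
  have gen : ∀ a : ℕ → ℝ, (∀ k, 0 ≤ a (k + 1)) → Summable (fun k => a (k + 1) * γ ^ (k + 1)) →
      ∀ f : ℕ → ℂ, (∀ m, ‖f m‖ ≤ γ ^ m) → ∀ n,
      Summable (fun k => (a (k + 1) : ℂ) * f (k + 1 + n)) ∧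
      ‖∑' k, (a (k + 1) : ℂ) * f (k + 1 + n)‖ ≤ γ ^ n * ∑' k, a (k + 1) * γ ^ (k + 1) := by
    intro a ha hs f hf n
    have hb : ∀ k, ‖(a (k + 1) : ℂ) * f (k + 1 + n)‖ ≤ γ ^ n * (a (k + 1) * γ ^ (k + 1)) := by
      intro k
      rw [norm_mul, Complex.norm_real, Real.norm_of_nonneg (ha k)]
      calc a (k + 1) * ‖f (k + 1 + n)‖ ≤ a (k + 1) * γ ^ (k + 1 + n) :=
            mul_le_mul_of_nonneg_left (hf _) (ha k)
        _ = _ := by rw [pow_add γ (k + 1) n]; ring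
    refine ⟨Summable.of_norm_bounded (hs.mul_left _) hb, ?_⟩
    rw [← tsum_mul_left]
    exact tsum_of_norm_bounded (hs.mul_left _).hasSum hb
  set K : ℝ := 1 + M / (ρ - p) with hK
  have hK0 : 0 ≤ M / (ρ - p) := div_nonneg hM0 (by linarith)
  have hKM : p * K + M ≤ ρ * K := by
    have : (ρ - p) * (M / (ρ - p)) = M := mul_div_cancel₀ M (by linarith)
    nlinarith
  refine ⟨B + K + 1, by linarith, ?_⟩
  intro n f hf m
  set ℓ : ℂ := ∑' i, (π i : ℂ) * f i with hℓ
  set u : ℕ → ℂ := fun n => (matActC P)^[n] f 0 with hu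
  let w : ℕ → ℂ := fun n => Nat.rec 0 (fun n x => p * u n + q * x) n
  have hw0 : w 0 = 0 := rfl
  have hw1 : ∀ n, w (n + 1) = p * u n + q * w n := fun n => rfl
  have hit : ∀ n, ∀ m, 1 ≤ m → (matActC P)^[n] f m = w n + q ^ n * f (m + n) := by
    intro n
    induction n with
    | zero => intro m hm; simp [hw0]
    | succ n ih =>
      intro m hm
      rw [Function.iterate_succ_apply', act1 _ m hm, ih (m + 1) (by omega), hw1,
        show m + 1 + n = m + (n + 1) by omega]
      simp only [hu]
      ring
  let e : ℕ → ℂ := fun n => ∑' k, (qseq (k + 1) : ℂ) * f (k + 1 + n)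
  let E : ℕ → ℂ := fun n => ∑' k, (π (k + 1) : ℂ) * f (k + 1 + n)
  have hes := gen qseq (fun k => (hq01 _ (by omega)).1) hmom f hf
  have hEs := gen π (fun k => hπ0 _) hπV' f hf
  have hqC : HasSum (fun k => (qseq (k + 1) : ℂ)) 1 := by
    have := Complex.hasSum_ofReal.2 hqsum
    rw [Complex.ofReal_one] at this
    exact this
  have hu1 : ∀ n, u (n + 1) = w n + q ^ n * e n := by
    intro n
    simp only [hu]
    rw [Function.iterate_succ_apply', act0]
    have h1 : HasSum (fun k => (qseq (k + 1) : ℂ) * w n + q ^ n * ((qseq (k + 1) : ℂ) * f (k + 1 + n)))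
        (1 * w n + q ^ n * e n) := (hqC.mul_right _).add ((hes n).1.hasSum.mul_left _)
    rw [one_mul] at h1
    rw [← h1.tsum_eq]
    refine tsum_congr fun k => ?_
    rw [hit n (k + 1) (by omega)]
    ring
  have hE1 : ∀ n, E n = π 0 * e n + q * E (n + 1) := by
    intro n
    have hEn : E n = π 1 * f (1 + n) + ∑' k, (π (k + 2) : ℂ) * f (k + 2 + n) := by
      have := (hEs n).1.tsum_eq_zero_add
      simpa [E] using this
    have hen : e n = qseq 1 * f (1 + n) + ∑' k, (qseq (k + 2) : ℂ) * f (k + 2 + n) := by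
      have := (hes n).1.tsum_eq_zero_add
      simpa [e] using this
    have hes2 : Summable fun k => (qseq (k + 2) : ℂ) * f (k + 2 + n) :=
      (summable_nat_add_iff (f := fun k => (qseq (k + 1) : ℂ) * f (k + 1 + n)) 1).2 (hes n).1
    have h1 := (hes2.hasSum.mul_left (π 0 : ℂ)).add ((hEs (n + 1)).1.hasSum.mul_left (q : ℂ))
    have h2 : ∑' k, (π (k + 2) : ℂ) * f (k + 2 + n) =
        π 0 * (∑' k, (qseq (k + 2) : ℂ) * f (k + 2 + n)) + q * E (n + 1) := by
      rw [← h1.tsum_eq]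
      refine tsum_congr fun k => ?_
      rw [pi2 k, show k + 1 + (n + 1) = k + 2 + n by omega]
      push_cast
      ring
    rw [hEn, h2, hen, pi1]
    push_cast
    ring
  have hqC' : (q : ℂ) = 1 - p := by rw [hpq]; push_cast; ring
  have pi0C : (p : ℂ) * (1 - π 0) = π 0 := by exact_mod_cast pi0
  have hinv : ∀ n, π 0 * u n + (1 - π 0) * w n + q ^ n * E n = ℓ := by
    intro n
    induction n with
    | zero =>
      have hs : Summable fun i => (π i : ℂ) * f i :=
        (summable_nat_add_iff (f := fun i => (π i : ℂ) * f i) 1).1 (by simpa using (hEs 0).1)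
      rw [hℓ, hs.tsum_eq_zero_add]
      simp [hw0, hu, E]
    | succ n ih =>
      rw [← ih, hu1, hw1, hE1 n, pow_succ]
      linear_combination (u n - w n) * pi0C + (1 - π 0 : ℂ) * w n * hqC'
  have hd : ∀ n, ‖u n - w n‖ ≤ K * ρ ^ n := by
    intro n
    induction n with
    | zero =>
      have := hf 0
      simp only [hw0, hu, Function.iterate_zero, id, sub_zero, pow_zero, mul_one] at this ⊢
      linarith
    | succ n ih =>
      have h1 : u (n + 1) - w (n + 1) = -(p * (u n - w n)) + q ^ n * e n := by
        rw [hu1, hw1, hqC']; ring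
      have h2 : ‖(p : ℂ) * (u n - w n)‖ ≤ p * (K * ρ ^ n) := by
        rw [norm_mul, Complex.norm_real, Real.norm_of_nonneg hp0.le]
        exact mul_le_mul_of_nonneg_left ih hp0.le
      have h3 : ‖(q : ℂ) ^ n * e n‖ ≤ M * ρ ^ n := by
        rw [norm_mul, norm_pow, Complex.norm_real, Real.norm_of_nonneg hqp.le]
        calc q ^ n * ‖e n‖ ≤ q ^ n * (γ ^ n * M) :=
              mul_le_mul_of_nonneg_left (hes n).2 (by positivity)
          _ = M * (q * γ) ^ n := by rw [mul_pow]; ring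
          _ ≤ M * ρ ^ n := by gcongr
      rw [h1]
      calc _ ≤ ‖-((p : ℂ) * (u n - w n))‖ + ‖(q : ℂ) ^ n * e n‖ := norm_add_le _ _
        _ ≤ p * (K * ρ ^ n) + M * ρ ^ n := by rw [norm_neg]; exact add_le_add h2 h3
        _ = (p * K + M) * ρ ^ n := by ring
        _ ≤ (ρ * K) * ρ ^ n := by gcongr
        _ = _ := by ring
  have hEb : ‖(q : ℂ) ^ n * E n‖ ≤ B * ρ ^ n := by
    rw [norm_mul, norm_pow, Complex.norm_real, Real.norm_of_nonneg hqp.le]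
    calc q ^ n * ‖E n‖ ≤ q ^ n * (γ ^ n * B) :=
          mul_le_mul_of_nonneg_left (hEs n).2 (by positivity)
      _ = B * (q * γ) ^ n := by rw [mul_pow]; ring
      _ ≤ B * ρ ^ n := by gcongr
  have hγm : 1 ≤ γ ^ m := one_le_pow₀ hγ1.le
  have hρn : 0 < ρ ^ n := by positivity
  have sc : ∀ t : ℝ, 0 ≤ t → t ≤ 1 → ‖(t : ℂ) * (u n - w n)‖ ≤ K * ρ ^ n := by
    intro t ht ht1
    rw [norm_mul, Complex.norm_real, Real.norm_of_nonneg ht]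
    have := hd n
    have h0 := norm_nonneg (u n - w n)
    nlinarith
  have hBK : 0 ≤ (B + K) * ρ ^ n := mul_nonneg (by linarith) hρn.le
  rcases Nat.eq_zero_or_pos m with rfl | hm
  · have h1 : (matActC P)^[n] f 0 - ℓ = ((1 - π 0 : ℝ) : ℂ) * (u n - w n) - q ^ n * E n := by
      rw [← hinv n]; push_cast; simp only [hu]; ring
    rw [h1, pow_zero, mul_one]
    have h2 := sc (1 - π 0) hπ01 (by linarith [hπ0 0])
    have := norm_sub_le (((1 - π 0 : ℝ) : ℂ) * (u n - w n)) ((q : ℂ) ^ n * E n)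
    nlinarith
  · have h1 : (matActC P)^[n] f m - ℓ =
        q ^ n * f (m + n) - ((π 0 : ℝ) : ℂ) * (u n - w n) - q ^ n * E n := by
      rw [← hinv n, hit n m hm]; ring
    rw [h1]
    have h2 := sc (π 0) (hπ0 0) (by linarith)
    have h3 : ‖(q : ℂ) ^ n * f (m + n)‖ ≤ ρ ^ n * γ ^ m := by
      rw [norm_mul, norm_pow, Complex.norm_real, Real.norm_of_nonneg hqp.le]
      calc q ^ n * ‖f (m + n)‖ ≤ q ^ n * γ ^ (m + n) :=
            mul_le_mul_of_nonneg_left (hf _) (by positivity)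
        _ = (q * γ) ^ n * γ ^ m := by rw [mul_pow, pow_add]; ring
        _ ≤ ρ ^ n * γ ^ m := by gcongr
    have h4 := norm_sub_le ((q : ℂ) ^ n * f (m + n) - ((π 0 : ℝ) : ℂ) * (u n - w n))
      ((q : ℂ) ^ n * E n)
    have h5 := norm_sub_le ((q : ℂ) ^ n * f (m + n)) (((π 0 : ℝ) : ℂ) * (u n - w n))
    nlinarith [mul_le_mul_of_nonneg_left hγm hBK]
end
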